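/- Let Q be a finite directed graph admitting a coloring c : V → ℤ/3ℤ, with all mixed-walk directed distances (forward cost 1, backward cost 2) finite, and fix three vertices z₁, z₂, z₃. For a vertex x set D(x) := δ(x,z₁) + δ(x,z₂) + δ(x,z₃). Then: (1) if v → u is an arrow of Q, then D(u) = D(v) if and only if exactly two of the three differences δ(u,z_m) − δ(v,z_m) (m = 1,2,3) are equal to −1, in which case the remaining one equals +2; (2) if w → v is an arrow of Q, then D(w) = D(v) if and only if exactly one of the three differences δ(w,z_m) − δ(v,z_m) equals −2, in which case the other two equal +1. -/

import Mathlib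

/-- `MixedWalk k A v w ℓ` : there is a mixed walk from `v` to `w` of total cost `ℓ`,
where each step traverses an arrow of `A` either forwards at cost `1` or backwards at
cost `k - 1` (so cost `2` when `k = 3`). -/
inductive MixedWalk {V : Type*} (k : ℕ) (A : V → V → Prop) : V → V → ℕ → Prop
  | nil (v : V) : MixedWalk k A v v 0
  | fwd {v w x : V} {ℓ : ℕ} : A v w → MixedWalk k A w x ℓ → MixedWalk k A v x (ℓ + 1)
  | bwd {v w x : V} {ℓ : ℕ} : A w v → MixedWalk k A w x ℓ → MixedWalk k A v x (ℓ + (k - 1))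

/-- A coloring of a directed graph: `c(w) = c(v) + 1` along every arrow `v → w`. -/
def IsColoring {V : Type*} (k : ℕ) (A : V → V → Prop) (c : V → ZMod k) : Prop :=
  ∀ v w : V, A v w → c w = c v + 1

theorem mixedWalk_color {V : Type*} {A : V → V → Prop} {c : V → ZMod 3}
    (hc : IsColoring 3 A c) {v w : V} {l : ℕ} (h : MixedWalk 3 A v w l) :
    c w = c v + (l : ZMod 3) := by
  have h3 : (3 : ZMod 3) = 0 := by decide
  induction h with
  | nil v => simp
  | fwd a _ ih => rw [ih, hc _ _ a]; push_cast; ring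
  | bwd a _ ih => rw [ih, hc _ _ a]; push_cast; linear_combination -h3

theorem mixedWalk_diff {V : Type*} {A : V → V → Prop} {c : V → ZMod 3}
    (hc : IsColoring 3 A c) {δ : V → V → ℕ}
    (hδ : ∀ v w : V, IsLeast {l : ℕ | MixedWalk 3 A v w l} (δ v w))
    {v u : V} (a : A v u) (z : V) :
    δ v z = δ u z + 1 ∨ δ u z = δ v z + 2 := by
  have h1 : δ v z ≤ δ u z + 1 := (hδ v z).2 (MixedWalk.fwd a (hδ u z).1)
  have h2 : δ u z ≤ δ v z + 2 := (hδ u z).2 (MixedWalk.bwd a (hδ v z).1)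
  have e1 := mixedWalk_color hc (hδ v z).1
  have e2 := mixedWalk_color hc (MixedWalk.fwd a (hδ u z).1)
  have e3 : ((δ v z : ℕ) : ZMod 3) = ((δ u z + 1 : ℕ) : ZMod 3) :=
    add_left_cancel (e1.symm.trans e2)
  rw [ZMod.natCast_eq_natCast_iff'] at e3
  omega

/-- Fix three vertices `z₁, z₂, z₃` and set `D(x) = δ(x,z₁) + δ(x,z₂) + δ(x,z₃)`.
(1) For an arrow `v → u`: `D(u) = D(v)` iff exactly two of the three differences
`δ(u,z_m) − δ(v,z_m)` equal `−1` and the remaining one equals `+2`.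
(2) For an arrow `w → v`: `D(w) = D(v)` iff exactly one of the three differences
`δ(w,z_m) − δ(v,z_m)` equals `−2` and the other two equal `+1`. -/
theorem stmt_6 {V : Type} [Fintype V] (A : V → V → Prop)
    (c : V → ZMod 3) (hc : IsColoring 3 A c)
    (δ : V → V → ℕ)
    (hδ : ∀ v w : V, IsLeast {ℓ : ℕ | MixedWalk 3 A v w ℓ} (δ v w))
    (z₁ z₂ z₃ : V) :
    (∀ v u : V, A v u →
      ((δ u z₁ + δ u z₂ + δ u z₃ = δ v z₁ + δ v z₂ + δ v z₃) ↔
        (((δ u z₁ : ℤ) - δ v z₁ = -1 ∧ (δ u z₂ : ℤ) - δ v z₂ = -1 ∧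
            (δ u z₃ : ℤ) - δ v z₃ = 2) ∨
         ((δ u z₁ : ℤ) - δ v z₁ = -1 ∧ (δ u z₂ : ℤ) - δ v z₂ = 2 ∧
            (δ u z₃ : ℤ) - δ v z₃ = -1) ∨
         ((δ u z₁ : ℤ) - δ v z₁ = 2 ∧ (δ u z₂ : ℤ) - δ v z₂ = -1 ∧
            (δ u z₃ : ℤ) - δ v z₃ = -1)))) ∧
    (∀ v w : V, A w v →
      ((δ w z₁ + δ w z₂ + δ w z₃ = δ v z₁ + δ v z₂ + δ v z₃) ↔
        (((δ w z₁ : ℤ) - δ v z₁ = -2 ∧ (δ w z₂ : ℤ) - δ v z₂ = 1 ∧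
            (δ w z₃ : ℤ) - δ v z₃ = 1) ∨
         ((δ w z₁ : ℤ) - δ v z₁ = 1 ∧ (δ w z₂ : ℤ) - δ v z₂ = -2 ∧
            (δ w z₃ : ℤ) - δ v z₃ = 1) ∨
         ((δ w z₁ : ℤ) - δ v z₁ = 1 ∧ (δ w z₂ : ℤ) - δ v z₂ = 1 ∧
            (δ w z₃ : ℤ) - δ v z₃ = -2)))) := by
  constructor
  · intro v u a
    have h1 := mixedWalk_diff hc hδ a z₁
    have h2 := mixedWalk_diff hc hδ a z₂
    have h3 := mixedWalk_diff hc hδ a z₃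
    omega
  · intro v w a
    have h1 := mixedWalk_diff hc hδ a z₁
    have h2 := mixedWalk_diff hc hδ a z₂
    have h3 := mixedWalk_diff hc hδ a z₃
    omega
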